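/- arXiv:1904.08715 — 3 statements merged into one kernel-verified Lean document; each statement's English description precedes it below -/
import Mathlib

section
/- For every α > 0 and every z ∈ ℂ, the series ∑_{k=0}^∞ z^k / Γ(αk + 1) defining the one-parameter Mittag-Leffler function E_α(z) is absolutely convergent (the family k ↦ z^k / Γ(αk + 1) is summable). -/
open MeasureTheory in
/-- Restricting the Euler integral of `Γ(s + 1)` to `(c, ∞)` bounds it below by `c ^ s * exp (-c)`. -/
theorem Real.rpow_mul_exp_neg_le_Gamma_add_one {c s : ℝ} (hc : 0 ≤ c) (hs : 0 ≤ s) :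
    c ^ s * Real.exp (-c) ≤ Real.Gamma (s + 1) := by
  have hΓ : IntegrableOn (fun x : ℝ => Real.exp (-x) * x ^ (s + 1 - 1)) (Set.Ioi 0) :=
    Real.GammaIntegral_convergent (by linarith)
  have hsub : Set.Ioi c ⊆ Set.Ioi 0 := Set.Ioi_subset_Ioi hc
  calc c ^ s * Real.exp (-c) = ∫ x in Set.Ioi c, c ^ s * Real.exp (-x) := by
        rw [integral_const_mul, integral_exp_neg_Ioi]
    _ ≤ ∫ x in Set.Ioi c, Real.exp (-x) * x ^ (s + 1 - 1) := by
        refine setIntegral_mono_on ((integrableOn_exp_neg_Ioi c).const_mul _) (hΓ.mono_set hsub)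
          measurableSet_Ioi fun x hx => ?_
        rw [add_sub_cancel_right, mul_comm]
        gcongr
        exact le_of_lt hx
    _ ≤ ∫ x in Set.Ioi 0, Real.exp (-x) * x ^ (s + 1 - 1) := by
        refine setIntegral_mono_set hΓ ?_ hsub.eventuallyLE
        filter_upwards [ae_restrict_mem measurableSet_Ioi] with x hx
        have : (0 : ℝ) < x := hx
        simp only [Pi.zero_apply]
        positivity
    _ = Real.Gamma (s + 1) := (Real.Gamma_eq_integral (by linarith)).symm

/-- For every `α > 0` and every `z ∈ ℂ`, the series
`∑_{k=0}^∞ z^k / Γ(αk + 1)` defining the one-parameter Mittag-Leffler function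
`E_α(z)` is absolutely convergent (the family is summable). -/
theorem mittagLeffler_one_param_summable (α : ℝ) (hα : 0 < α) (z : ℂ) :
    Summable (fun k : ℕ => z ^ k / Complex.Gamma (α * k + 1)) := by
  have hpos : 0 < ‖z‖ + 1 := by positivity
  set c : ℝ := (‖z‖ + 1) ^ α⁻¹
  have hgeom : Summable fun k : ℕ => (‖z‖ / (‖z‖ + 1)) ^ k * Real.exp c :=
    (summable_geometric_of_lt_one (by positivity)
      ((div_lt_one hpos).2 (lt_add_one _))).mul_right _
  refine hgeom.of_norm_bounded fun k => ?_
  have hcpow : c ^ (α * k) = (‖z‖ + 1) ^ k := by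
    rw [← Real.rpow_mul hpos.le, inv_mul_cancel_left₀ hα.ne', Real.rpow_natCast]
  have hGamma : (‖z‖ + 1) ^ k * Real.exp (-c) ≤ Real.Gamma (α * k + 1) :=
    hcpow ▸ Real.rpow_mul_exp_neg_le_Gamma_add_one (by positivity) (by positivity)
  have hnorm : ‖Complex.Gamma (α * k + 1)‖ = Real.Gamma (α * k + 1) := by
    have hcast : (α * k + 1 : ℂ) = ((α * k + 1 : ℝ) : ℂ) := by push_cast; rfl
    rw [hcast, Complex.Gamma_ofReal, Complex.norm_of_nonneg]
    exact (Real.Gamma_pos_of_pos (by positivity)).le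
  calc ‖z ^ k / Complex.Gamma (α * k + 1)‖ = ‖z‖ ^ k / Real.Gamma (α * k + 1) := by
        rw [norm_div, norm_pow, hnorm]
    _ ≤ ‖z‖ ^ k / ((‖z‖ + 1) ^ k * Real.exp (-c)) := by gcongr
    _ = (‖z‖ / (‖z‖ + 1)) ^ k * Real.exp c := by
        rw [Real.exp_neg, div_pow]
        field_simp
end

section
/- Let 0 < α, λ ∈ ℝ, and t > 0. Then the function f(t) = E_α(λ t^α) is differentiable at t with derivative f′(t) = λ t^{α−1} E_{α,α}(λ t^α). -/
/-- The real one-parameter Mittag-Leffler function `E_α(x) = ∑ x^k / Γ(αk + 1)`. -/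
noncomputable def realML (α x : ℝ) : ℝ := ∑' k : ℕ, x ^ k / Real.Gamma (α * k + 1)

/-- The real two-parameter Mittag-Leffler function `E_{α,β}(x) = ∑ x^k / Γ(αk + β)`. -/
noncomputable def realML2 (α β x : ℝ) : ℝ := ∑' k : ℕ, x ^ k / Real.Gamma (α * k + β)

/-- An exponential lower bound for the Gamma function, with arbitrary base `R`. -/
theorem rpow_mul_exp_neg_le_Gamma {R s : ℝ} (hR : 0 < R) (hs : 1 ≤ s) :
    R ^ (s - 1) * Real.exp (-R) ≤ Real.Gamma s := by
  have hs0 : 0 < s := one_pos.trans_le hs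
  have hint := Real.GammaIntegral_convergent hs0
  have hsub : Set.Ioi R ⊆ Set.Ioi 0 := Set.Ioi_subset_Ioi hR.le
  calc R ^ (s - 1) * Real.exp (-R) = ∫ x in Set.Ioi R, Real.exp (-x) * R ^ (s - 1) := by
        rw [MeasureTheory.integral_mul_const, integral_exp_neg_Ioi, mul_comm]
    _ ≤ ∫ x in Set.Ioi R, Real.exp (-x) * x ^ (s - 1) := by
        refine MeasureTheory.setIntegral_mono_on ((integrableOn_exp_neg_Ioi R).mul_const _)
          (hint.mono_set hsub) measurableSet_Ioi fun x hx => ?_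
        exact mul_le_mul_of_nonneg_left
          (Real.rpow_le_rpow hR.le (le_of_lt hx) (sub_nonneg.2 hs)) (Real.exp_pos _).le
    _ ≤ ∫ x in Set.Ioi 0, Real.exp (-x) * x ^ (s - 1) := by
        refine MeasureTheory.setIntegral_mono_set hint ?_ hsub.eventuallyLE
        filter_upwards [MeasureTheory.ae_restrict_mem measurableSet_Ioi] with x hx
        exact mul_nonneg (Real.exp_pos _).le (Real.rpow_nonneg (le_of_lt hx) _)
    _ = Real.Gamma s := (Real.Gamma_eq_integral hs0).symm

/-- The series defining the two-parameter Mittag-Leffler function converges everywhere. -/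
theorem summable_realML2 {α : ℝ} (hα : 0 < α) (β x : ℝ) :
    Summable fun k : ℕ => x ^ k / Real.Gamma (α * k + β) := by
  set y := 2 * (|x| + 1)
  have hy0 : 0 < y := by positivity
  set R := y ^ α⁻¹
  have hR0 : 0 < R := Real.rpow_pos_of_pos hy0 _
  have hRα : R ^ α = y := Real.rpow_inv_rpow hy0.le hα.ne'
  have hratio : |x| / y < 1 := (div_lt_one hy0).2 (by linarith [abs_nonneg x])
  refine Summable.of_norm_bounded_eventually_nat
    (g := fun k : ℕ => (R ^ (β - 1) * Real.exp (-R))⁻¹ * (|x| / y) ^ k)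
    ((summable_geometric_of_lt_one (by positivity) hratio).mul_left _) ?_
  have hlarge : ∀ᶠ k : ℕ in Filter.atTop, 1 ≤ α * k + β :=
    (Filter.tendsto_atTop_add_const_right _ β
      (tendsto_natCast_atTop_atTop.const_mul_atTop hα)).eventually_ge_atTop 1
  filter_upwards [hlarge] with k hk
  have hpow : R ^ (α * k + β - 1) = y ^ k * R ^ (β - 1) := by
    rw [add_sub_assoc, Real.rpow_add hR0, Real.rpow_mul hR0.le, hRα, Real.rpow_natCast]
  have hle := rpow_mul_exp_neg_le_Gamma hR0 hk
  rw [hpow] at hle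
  rw [norm_div, norm_pow, Real.norm_eq_abs, Real.norm_eq_abs,
    abs_of_pos (Real.Gamma_pos_of_pos (one_pos.trans_le hk))]
  calc |x| ^ k / Real.Gamma (α * k + β) ≤ |x| ^ k / (y ^ k * R ^ (β - 1) * Real.exp (-R)) := by
        gcongr
    _ = (R ^ (β - 1) * Real.exp (-R))⁻¹ * (|x| / y) ^ k := by
        rw [div_pow]
        field_simp

/-- The derivative of `E_α` is `E_{α,α} / α`. -/
theorem hasDerivAt_realML {α : ℝ} (hα : 0 < α) (x : ℝ) :
    HasDerivAt (realML α) (realML2 α α x / α) x := by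
  have hsplit : realML α = fun y => 1 + ∑' k : ℕ, y ^ (k + 1) / Real.Gamma (α * (k + 1) + 1) := by
    ext y
    rw [realML, (summable_realML2 hα 1 y).tsum_eq_zero_add]
    simp
  rw [hsplit, realML2, ← tsum_div_const]
  refine HasDerivAt.const_add _ ?_
  refine hasDerivAt_tsum_of_isPreconnected
    (g := fun (k : ℕ) y => y ^ (k + 1) / Real.Gamma (α * (k + 1) + 1))
    (g' := fun (k : ℕ) y => y ^ k / Real.Gamma (α * k + α) / α) (y := x)
    (t := Metric.ball 0 (|x| + 1))
    (u := fun k : ℕ => (|x| + 1) ^ k / Real.Gamma (α * k + α) / α)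
    (y₀ := x) ((summable_realML2 hα α _).div_const α) Metric.isOpen_ball
    (convex_ball _ _).isPreconnected (fun k y _ => ?_) (fun k y hy => ?_) (by simp)
    (by simpa using (summable_nat_add_iff 1).2 (summable_realML2 hα 1 x)) (by simp)
  · have hΓ : Real.Gamma (α * k + α) ≠ 0 := (Real.Gamma_pos_of_pos (by positivity)).ne'
    convert! (hasDerivAt_pow (k + 1) y).div_const (Real.Gamma (α * (k + 1) + 1)) using 1
    rw [Real.Gamma_add_one (by positivity), mul_add_one α (k : ℝ)]
    push_cast
    field_simp
  · have hΓ : 0 < Real.Gamma (α * k + α) := Real.Gamma_pos_of_pos (by positivity)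
    have hy' : |y| ≤ |x| + 1 := by simpa using (mem_ball_zero_iff.1 hy).le
    rw [norm_div, norm_div, norm_pow, Real.norm_eq_abs, Real.norm_eq_abs, Real.norm_eq_abs,
      abs_of_pos hΓ, abs_of_pos hα]
    gcongr

/-- For `0 < α`, `λ ∈ ℝ` and `t > 0`, the function
`f(t) = E_α(λ t^α)` is differentiable at `t` with derivative
`f′(t) = λ t^(α−1) E_{α,α}(λ t^α)`. -/
theorem hasDerivAt_realML_rpow (α lam t : ℝ) (hα : 0 < α) (ht : 0 < t) :
    HasDerivAt (fun s : ℝ => realML α (lam * s ^ α))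
      (lam * t ^ (α - 1) * realML2 α α (lam * t ^ α)) t := by
  have h := (hasDerivAt_realML hα (lam * t ^ α)).comp t
    ((Real.hasDerivAt_rpow_const (p := α) (Or.inl ht.ne')).const_mul lam)
  convert! h using 1
  field_simp
end

section
/- Let α > 0, λ₁, λ₂ ∈ ℝ, t₁ ≥ 0, let A = diag(λ₁, λ₂), and let X₀ ∈ ℝ². Define X(t) = E_α(t^α A) X₀ and Y(t) = E_α(t^α A) X(t₁), with speeds ν₁(t) = ‖X′(t)‖ and ν₂(t) = ‖Y′(t)‖. Suppose X is twice differentiable at a point t > 0, ν₁(t) ≠ 0, and ν₂(t) ≠ 0. Then the unsigned curvatures satisfy κ_Y(t) = |E_α(λ₁ t₁^α) · E_α(λ₂ t₁^α)| · (ν₁(t)³ / ν₂(t)³) · κ_X(t), where for a plane curve γ = (u, v) the unsigned curvature is κ_γ(t) = |u′(t) v″(t) − v′(t) u″(t)| / (u′(t)² + v′(t)²)^{3/2}. -/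
open Matrix

/-- The matrix Mittag-Leffler function `E_α(B) = ∑ B^k / Γ(αk + 1)`. -/
noncomputable def matrixML {n : ℕ} (α : ℝ) (B : Matrix (Fin n) (Fin n) ℝ) :
    Matrix (Fin n) (Fin n) ℝ :=
  ∑' k : ℕ, (Real.Gamma (α * k + 1))⁻¹ • B ^ k

/-- The unsigned curvature of the plane curve `γ = (u, v)` at `t`:
`κ = |u′ v″ − v′ u″| / ((u′)² + (v′)²)^(3/2)`. -/
noncomputable def unsignedCurvature (u v : ℝ → ℝ) (t : ℝ) : ℝ :=
  |deriv u t * deriv (deriv v) t - deriv v t * deriv (deriv u) t| /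
    ((deriv u t) ^ 2 + (deriv v t) ^ 2) ^ ((3 : ℝ) / 2)

/-- The speed of the plane curve `γ = (u, v)` at `t`. -/
noncomputable def speed (u v : ℝ → ℝ) (t : ℝ) : ℝ :=
  Real.sqrt ((deriv u t) ^ 2 + (deriv v t) ^ 2)

theorem rpow_mul_exp_neg_le_Gamma_s17 {M y : ℝ} (hM : 0 < M) (hy : 0 ≤ y) :
    M ^ y * Real.exp (-M) ≤ Real.Gamma (y + 1) := by
  have hint : MeasureTheory.IntegrableOn (fun x : ℝ => Real.exp (-x) * x ^ (y + 1 - 1))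
      (Set.Ioi 0) := Real.GammaIntegral_convergent (by linarith)
  have hsub : Set.Ioi M ⊆ Set.Ioi (0 : ℝ) := Set.Ioi_subset_Ioi hM.le
  rw [Real.Gamma_eq_integral (by linarith), ← integral_exp_neg_Ioi M,
    ← MeasureTheory.integral_const_mul]
  calc ∫ x in Set.Ioi M, M ^ y * Real.exp (-x)
      ≤ ∫ x in Set.Ioi M, Real.exp (-x) * x ^ (y + 1 - 1) := by
        refine MeasureTheory.setIntegral_mono_on
          ((integrableOn_exp_neg_Ioi M).const_mul _) (hint.mono_set hsub) measurableSet_Ioi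
          fun x hx => ?_
        rw [add_sub_cancel_right, mul_comm]
        gcongr
        exact le_of_lt hx
    _ ≤ ∫ x in Set.Ioi 0, Real.exp (-x) * x ^ (y + 1 - 1) := by
        refine MeasureTheory.setIntegral_mono_set hint ?_ hsub.eventuallyLE
        filter_upwards [MeasureTheory.ae_restrict_mem measurableSet_Ioi] with x hx
        have hx' : (0 : ℝ) < x := hx
        simp only [Pi.zero_apply]
        positivity

theorem summable_realML {α : ℝ} (hα : 0 < α) (x : ℝ) :
    Summable fun k : ℕ => x ^ k / Real.Gamma (α * k + 1) := by
  set b : ℝ := |x| + 1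
  have hb : 0 < b := by positivity
  set M : ℝ := b ^ α⁻¹
  have hM : 0 < M := by positivity
  have hgeom : Summable fun k : ℕ => Real.exp M * (|x| / b) ^ k :=
    (summable_geometric_of_lt_one (by positivity)
      ((div_lt_one hb).2 (lt_add_one |x|))).mul_left _
  refine hgeom.of_norm_bounded fun k => ?_
  have hk : 0 ≤ α * k := by positivity
  have hpow : M ^ (α * k) = b ^ k := by
    rw [Real.rpow_mul hM.le, Real.rpow_inv_rpow hb.le hα.ne', Real.rpow_natCast]
  have hΓ := rpow_mul_exp_neg_le_Gamma_s17 hM hk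
  rw [hpow] at hΓ
  rw [norm_div, norm_pow, Real.norm_eq_abs, Real.norm_eq_abs,
    abs_of_pos (Real.Gamma_pos_of_pos (by linarith : 0 < α * k + 1))]
  calc |x| ^ k / Real.Gamma (α * k + 1) ≤ |x| ^ k / (b ^ k * Real.exp (-M)) := by gcongr
    _ = Real.exp M * (|x| / b) ^ k := by
        rw [Real.exp_neg, div_pow]
        field_simp

theorem matrixML_diagonal {n : ℕ} {α : ℝ} (hα : 0 < α) (d : Fin n → ℝ) :
    matrixML α (Matrix.diagonal d) = Matrix.diagonal fun i => realML α (d i) := by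
  have hsum : HasSum (fun k : ℕ => fun i => d i ^ k / Real.Gamma (α * k + 1))
      (fun i => realML α (d i)) :=
    Pi.hasSum.2 fun i => (summable_realML hα (d i)).hasSum
  rw [matrixML, ← hsum.matrix_diagonal.tsum_eq]
  refine tsum_congr fun k => ?_
  rw [Matrix.diagonal_pow, ← Matrix.diagonal_smul]
  congr 1
  ext i
  simp [div_eq_inv_mul]

theorem rpow_three_halves_eq_sqrt_pow {x : ℝ} (hx : 0 ≤ x) :
    x ^ ((3 : ℝ) / 2) = Real.sqrt x ^ 3 := by
  rw [Real.sqrt_eq_rpow, ← Real.rpow_mul_natCast hx]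
  norm_num

theorem unsignedCurvature_eq_div_speed_pow (u v : ℝ → ℝ) (t : ℝ) :
    unsignedCurvature u v t =
      |deriv u t * deriv (deriv v) t - deriv v t * deriv (deriv u) t| / speed u v t ^ 3 := by
  rw [unsignedCurvature, speed, rpow_three_halves_eq_sqrt_pow (by positivity)]

theorem unsignedCurvature_const_mul (a b : ℝ) (u v : ℝ → ℝ) (t : ℝ) (h : speed u v t ≠ 0) :
    unsignedCurvature (fun r => a * u r) (fun r => b * v r) t =
      |a * b| * (speed u v t ^ 3 / speed (fun r => a * u r) (fun r => b * v r) t ^ 3) *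
        unsignedCurvature u v t := by
  have hderiv (c : ℝ) (f : ℝ → ℝ) : deriv (fun r => c * f r) = fun r => c * deriv f r :=
    funext fun _ => deriv_const_mul_field c
  have hdet : deriv (fun r => a * u r) t * deriv (deriv fun r => b * v r) t -
      deriv (fun r => b * v r) t * deriv (deriv fun r => a * u r) t =
      a * b * (deriv u t * deriv (deriv v) t - deriv v t * deriv (deriv u) t) := by
    simp only [hderiv]
    ring
  rw [unsignedCurvature_eq_div_speed_pow, unsignedCurvature_eq_div_speed_pow, hdet, abs_mul]
  field_simp

/-- For `α > 0`, `λ₁, λ₂ ∈ ℝ`, `t₁ ≥ 0`, `A = diag(λ₁, λ₂)`, `X₀ ∈ ℝ²`,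
`X(t) = E_α(t^α A) X₀`, `Y(t) = E_α(t^α A) X(t₁)`, with speeds `ν₁(t) = ‖X′(t)‖` and
`ν₂(t) = ‖Y′(t)‖`: if `X` is twice differentiable at `t > 0`, `ν₁(t) ≠ 0` and
`ν₂(t) ≠ 0`, then the unsigned curvatures satisfy
`κ_Y(t) = |E_α(λ₁ t₁^α) E_α(λ₂ t₁^α)| (ν₁(t)³ / ν₂(t)³) κ_X(t)`. -/
theorem curvature_scaling_diagonal (α : ℝ) (hα : 0 < α) (lam₁ lam₂ t₁ : ℝ) (ht₁ : 0 ≤ t₁)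
    (A : Matrix (Fin 2) (Fin 2) ℝ) (hA : A = Matrix.diagonal ![lam₁, lam₂]) (X₀ : Fin 2 → ℝ)
    (X Y : ℝ → (Fin 2 → ℝ))
    (hX : ∀ t, X t = (matrixML α ((t ^ α) • A)).mulVec X₀)
    (hY : ∀ t, Y t = (matrixML α ((t ^ α) • A)).mulVec (X t₁))
    (t : ℝ) (ht : 0 < t)
    -- `X` is twice differentiable at `t`
    (hXd : ∀ᶠ s in nhds t,
      DifferentiableAt ℝ (fun r => X r 0) s ∧ DifferentiableAt ℝ (fun r => X r 1) s)
    (hXd2 : DifferentiableAt ℝ (deriv (fun r => X r 0)) t ∧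
            DifferentiableAt ℝ (deriv (fun r => X r 1)) t)
    (hν₁ : speed (fun r => X r 0) (fun r => X r 1) t ≠ 0)
    (hν₂ : speed (fun r => Y r 0) (fun r => Y r 1) t ≠ 0) :
    unsignedCurvature (fun r => Y r 0) (fun r => Y r 1) t =
      |realML α (lam₁ * t₁ ^ α) * realML α (lam₂ * t₁ ^ α)| *
        ((speed (fun r => X r 0) (fun r => X r 1) t) ^ 3 /
          (speed (fun r => Y r 0) (fun r => Y r 1) t) ^ 3) *
        unsignedCurvature (fun r => X r 0) (fun r => X r 1) t := by
  have hML (s : ℝ) (V : Fin 2 → ℝ) (i : Fin 2) :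
      (matrixML α ((s ^ α) • A)).mulVec V i = realML α (![lam₁, lam₂] i * s ^ α) * V i := by
    rw [hA, ← Matrix.diagonal_smul, matrixML_diagonal hα, Matrix.mulVec_diagonal]
    simp [mul_comm]
  have hYX (i : Fin 2) :
      (fun r => Y r i) = fun r => realML α (![lam₁, lam₂] i * t₁ ^ α) * X r i := by
    funext r
    rw [hY, hML, hX, hML, hX, hML]
    ring
  rw [hYX 0, hYX 1]
  exact unsignedCurvature_const_mul _ _ _ _ t hν₁
end
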